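/- Fix a real N>0 and 0<δ<1, and let λ(δ) = N·log((1+δ)/(1−δ)). The cylindrical slit map S^{N,δ} is holomorphic and injective on the open strip Σ_N = {z ∈ ℂ : −Nπ < Re z < Nπ, Im z > 0}, and its image is Σ_N ∖ {it : 0 < t ≤ λ(δ)}, i.e. the strip with the vertical slit of length λ(δ) above the origin removed. (S^{N,δ} is a conformal map of the cylinder 𝕋^N onto the cylinder with a slit of length λ(δ) attached at 0.) -/

import Mathlib

open Complex Filter

/-- The map `f_N(z) = exp(-iz/N)` from the cylinder to the complement of the unit disk. -/
noncomputable def fN (N : ℝ) (z : ℂ) : ℂ := Complex.exp (-Complex.I * z / N)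

/-- The inverse map `f_N⁻¹(w) = iN·Log w` (principal branch). -/
noncomputable def fNinv (N : ℝ) (w : ℂ) : ℂ := Complex.I * N * Complex.log w

/-- The Möbius map `g(z) = i(z-1)/(z+1)`. -/
noncomputable def gMap (z : ℂ) : ℂ := Complex.I * (z - 1) / (z + 1)

/-- The inverse Möbius map `g⁻¹(w) = (i+w)/(i-w)`. -/
noncomputable def gInv (w : ℂ) : ℂ := (Complex.I + w) / (Complex.I - w)

/-- The half-plane slit map `φ^δ(z) = z·(1-δ²-δ²/z²)^{1/2}` (principal square root). -/
noncomputable def phiSlit (δ : ℝ) (z : ℂ) : ℂ :=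
  z * (1 - (δ:ℂ)^2 - (δ:ℂ)^2 / z^2) ^ ((1:ℂ)/2)

/-- The cylindrical slit map `S^{N,δ} = f_N⁻¹∘g⁻¹∘φ^δ∘g∘f_N`. -/
noncomputable def cylSlit (N δ : ℝ) (z : ℂ) : ℂ :=
  fNinv N (gInv (phiSlit δ (gMap (fN N z))))

/-- The slit-size parameter `δ(N,λ) = 1 - 2/(1+e^{λ/N})`. -/
noncomputable def deltaN (N lam : ℝ) : ℝ := 1 - 2 / (1 + Real.exp (lam / N))

/-- The open strip `Σ_N`. -/
def openStrip (N : ℝ) : Set ℂ := {z : ℂ | -(N * Real.pi) < z.re ∧ z.re < N * Real.pi ∧ 0 < z.im}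

/-- The exterior of the closed unit disk, cut along the negative real axis. -/
def slitExterior : Set ℂ := {v : ℂ | 1 < ‖v‖ ∧ v ∈ slitPlane}

/-- The upper half-plane, cut along the vertical ray from `i` to `i∞`. -/
def slitHalfPlane : Set ℂ := {w : ℂ | 0 < w.im ∧ ∀ t : ℝ, 1 ≤ t → w ≠ t * I}

lemma neg_I_mul_div_re (N : ℝ) (z : ℂ) : (-I * z / N).re = z.im / N := by
  simp [Complex.div_ofReal_re]

lemma neg_I_mul_div_im (N : ℝ) (z : ℂ) : (-I * z / N).im = -z.re / N := by
  simp [Complex.div_ofReal_im]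

lemma fN_mapsTo {N : ℝ} (hN : 0 < N) : Set.MapsTo (fN N) (openStrip N) slitExterior := by
  rintro z ⟨h1, h2, h3⟩
  refine ⟨?_, ?_⟩
  · rw [fN, Complex.norm_exp, neg_I_mul_div_re]
    exact Real.one_lt_exp_iff.2 (by positivity)
  · rw [fN, Complex.exp_mem_slitPlane, neg_I_mul_div_im, (toIocMod_eq_self _).2]
    · intro h
      rw [div_eq_iff hN.ne'] at h
      linarith
    · constructor
      · rw [lt_div_iff₀ hN]; linarith
      · rw [div_le_iff₀ hN]; linarith

lemma fNinv_mapsTo {N : ℝ} (hN : 0 < N) : Set.MapsTo (fNinv N) slitExterior (openStrip N) := by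
  rintro v ⟨h1, h2⟩
  have hlog : 0 < Real.log ‖v‖ := Real.log_pos h1
  have harg := mem_slitPlane_iff_arg.1 h2
  have hlt : arg v < Real.pi := lt_of_le_of_ne (arg_le_pi v) harg.1
  have hgt := neg_pi_lt_arg v
  have hre : (fNinv N v).re = -(N * arg v) := by simp [fNinv, Complex.log_im]
  have him : (fNinv N v).im = N * Real.log ‖v‖ := by simp [fNinv, Complex.log_re]
  refine ⟨?_, ?_, ?_⟩
  · rw [hre]; nlinarith
  · rw [hre]; nlinarith
  · rw [him]; positivity

lemma fNinv_fN {N : ℝ} (hN : 0 < N) {z : ℂ} (hz : z ∈ openStrip N) : fNinv N (fN N z) = z := by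
  obtain ⟨h1, h2, h3⟩ := hz
  have hN' : (N : ℂ) ≠ 0 := ofReal_ne_zero.2 hN.ne'
  rw [fNinv, fN, Complex.log_exp]
  · field_simp
    linear_combination (-z) * I_sq
  · rw [neg_I_mul_div_im, lt_div_iff₀ hN]; linarith
  · rw [neg_I_mul_div_im, div_le_iff₀ hN]; linarith

lemma fN_fNinv {N : ℝ} (hN : 0 < N) {v : ℂ} (hv : v ≠ 0) : fN N (fNinv N v) = v := by
  have hN' : (N : ℂ) ≠ 0 := ofReal_ne_zero.2 hN.ne'
  have : -I * (I * N * log v) / N = log v := by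
    field_simp
    linear_combination (-log v) * I_sq
  rw [fN, fNinv, this, exp_log hv]

lemma add_one_ne_zero_of_mem_slitExterior {v : ℂ} (hv : v ∈ slitExterior) : v + 1 ≠ 0 := by
  intro h
  have h1 := hv.1
  rw [eq_neg_of_add_eq_zero_left h] at h1
  simp at h1

lemma I_sub_ne_zero_of_mem_slitHalfPlane {w : ℂ} (hw : w ∈ slitHalfPlane) : I - w ≠ 0 := by
  intro h
  exact hw.2 1 le_rfl (by rw [← sub_eq_zero.1 h]; simp)

lemma gInv_gMap {v : ℂ} (hv : v + 1 ≠ 0) : gInv (gMap v) = v := by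
  have h2 : I - I * (v - 1) / (v + 1) = 2 * I / (v + 1) := by field_simp; ring
  rw [gInv, gMap, h2]
  field_simp
  ring

lemma gMap_gInv {w : ℂ} (hw : I - w ≠ 0) : gMap (gInv w) = w := by
  have h2 : (I + w) / (I - w) + 1 = 2 * I / (I - w) := by field_simp; ring
  rw [gMap, gInv, h2]
  field_simp
  ring

lemma gMap_im (v : ℂ) : (gMap v).im = (‖v‖ ^ 2 - 1) / normSq (v + 1) := by
  rw [gMap, Complex.div_im, ← normSq_eq_norm_sq, normSq_apply v]
  simp
  ring

lemma gMap_mapsTo : Set.MapsTo gMap slitExterior slitHalfPlane := by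
  intro v hv
  have hv1 := add_one_ne_zero_of_mem_slitExterior hv
  refine ⟨?_, fun t ht h => ?_⟩
  · rw [gMap_im]
    have := normSq_pos.2 hv1
    have := hv.1
    exact div_pos (by nlinarith) ‹_›
  · rw [gMap, div_eq_iff hv1] at h
    have h2 : v - 1 = t * (v + 1) := mul_left_cancel₀ I_ne_zero (by linear_combination h)
    have hre := congrArg re h2
    have him := congrArg im h2
    simp at hre him
    have ht1 : t ≠ 1 := by rintro rfl; linarith
    have hi : v.im = 0 := by
      have : v.im * (1 - t) = 0 := by linarith
      rcases mul_eq_zero.1 this with h | h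
      · exact h
      · exact absurd (by linarith) ht1
    rcases hv.2 with h | h
    · have : 1 < t := lt_of_le_of_ne ht ht1.symm
      nlinarith
    · exact h hi

lemma gInv_mapsTo : Set.MapsTo gInv slitHalfPlane slitExterior := by
  intro w hw
  have hw1 := I_sub_ne_zero_of_mem_slitHalfPlane hw
  have hn : 1 < ‖gInv w‖ := by
    rw [gInv, norm_div, one_lt_div (norm_pos_iff.2 hw1)]
    refine lt_of_pow_lt_pow_left₀ 2 (norm_nonneg _) ?_
    rw [← normSq_eq_norm_sq, ← normSq_eq_norm_sq, normSq_apply, normSq_apply]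
    simp
    nlinarith [hw.1]
  refine ⟨hn, ?_⟩
  by_contra hs
  rw [mem_slitPlane_iff, not_or, not_lt, not_not] at hs
  set r := (gInv w).re with hr
  have hg : gInv w = (r : ℂ) := Complex.ext (by simp [hr]) (by simp [hs.2])
  rw [hg, norm_real, Real.norm_eq_abs, abs_of_nonpos hs.1] at hn
  have hr1 : (r : ℂ) + 1 ≠ 0 := by
    have : r + 1 ≠ 0 := by linarith
    exact_mod_cast this
  refine hw.2 ((r - 1) / (r + 1)) ?_ ?_
  · rw [le_div_iff_of_neg (by linarith)]; linarith
  · rw [← gMap_gInv hw1, hg, gMap]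
    push_cast
    ring

lemma phiSlit_radicand_im (δ : ℝ) (z : ℂ) :
    (1 - (δ : ℂ) ^ 2 - (δ : ℂ) ^ 2 / z ^ 2).im = 2 * δ ^ 2 * z.re * z.im / normSq z ^ 2 := by
  have : ((δ : ℂ) ^ 2) = ((δ ^ 2 : ℝ) : ℂ) := by push_cast; rfl
  rw [this, sub_im, div_im, map_pow normSq]
  simp [pow_two]
  ring

lemma phiSlit_radicand_mem_slitPlane {δ : ℝ} (hδ : 0 < δ) (hδ1 : δ < 1) {z : ℂ} (hz : 0 < z.im) :
    1 - (δ : ℂ) ^ 2 - (δ : ℂ) ^ 2 / z ^ 2 ∈ slitPlane := by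
  by_cases hx : z.re = 0
  · have hz' : z = z.im * I := Complex.ext (by simp [hx]) (by simp)
    have hy : (z.im : ℂ) ≠ 0 := ofReal_ne_zero.2 hz.ne'
    have : 1 - (δ : ℂ) ^ 2 - (δ : ℂ) ^ 2 / z ^ 2 = ((1 - δ ^ 2 + δ ^ 2 / z.im ^ 2 : ℝ) : ℂ) := by
      rw [hz', mul_pow, I_sq]
      push_cast
      simp [div_neg]
    rw [this, ofReal_mem_slitPlane]
    have : 0 < δ ^ 2 / z.im ^ 2 := by positivity
    nlinarith
  · right
    rw [phiSlit_radicand_im]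
    have : z ≠ 0 := by rintro rfl; simp at hz
    have := (normSq_pos.2 this).ne'
    have := hz.ne'
    have := hδ.ne'
    positivity

lemma cpow_half_sq (u : ℂ) : (u ^ ((1 : ℂ) / 2)) ^ 2 = u := by
  simp

lemma cpow_half_re_pos {u : ℂ} (hu : u ∈ slitPlane) : 0 < (u ^ ((1 : ℂ) / 2)).re := by
  have h0 : u ≠ 0 := slitPlane_ne_zero hu
  have harg := (mem_slitPlane_iff_arg.1 hu).1
  have hlt : arg u < Real.pi := lt_of_le_of_ne (arg_le_pi u) harg
  have hgt := neg_pi_lt_arg u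
  rw [cpow_def_of_ne_zero h0, exp_re]
  refine mul_pos (Real.exp_pos _) (Real.cos_pos_of_mem_Ioo ⟨?_, ?_⟩)
  · have : (log u * (1 / 2)).im = arg u / 2 := by
      simp [mul_im, log_im]; ring
    rw [this]; linarith
  · have : (log u * (1 / 2)).im = arg u / 2 := by
      simp [mul_im, log_im]; ring
    rw [this]; linarith

lemma phiSlit_sq (δ : ℝ) {z : ℂ} (hz : z ≠ 0) :
    phiSlit δ z ^ 2 = z ^ 2 * (1 - (δ : ℂ) ^ 2) - (δ : ℂ) ^ 2 := by
  rw [phiSlit, mul_pow, cpow_half_sq]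
  field_simp

lemma ne_zero_of_im_pos {z : ℂ} (hz : 0 < z.im) : z ≠ 0 := by
  rintro rfl
  simp at hz

lemma phiSlit_im_pos {δ : ℝ} (hδ : 0 < δ) (hδ1 : δ < 1) {z : ℂ} (hz : 0 < z.im) :
    0 < (phiSlit δ z).im := by
  have hu := phiSlit_radicand_mem_slitPlane hδ hδ1 hz
  have hs := cpow_half_re_pos hu
  have him := congrArg im (cpow_half_sq (1 - (δ : ℂ) ^ 2 - (δ : ℂ) ^ 2 / z ^ 2))
  rw [phiSlit_radicand_im] at him
  rw [phiSlit, mul_im]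
  set s := (1 - (δ : ℂ) ^ 2 - (δ : ℂ) ^ 2 / z ^ 2) ^ ((1 : ℂ) / 2)
  have hn := normSq_pos.2 (ne_zero_of_im_pos hz)
  have hprod : s.re * (z.re * s.im) = δ ^ 2 * z.re ^ 2 * z.im / normSq z ^ 2 := by
    rw [pow_two, mul_im] at him
    linear_combination z.re / 2 * him
  have h1 : 0 ≤ z.re * s.im := by
    refine nonneg_of_mul_nonneg_right (a := s.re) ?_ hs
    rw [hprod]
    positivity
  have h2 : 0 < z.im * s.re := mul_pos hz hs
  linarith

lemma eq_of_sq_eq_sq_of_im_pos {z w : ℂ} (hz : 0 < z.im) (hw : 0 < w.im) (h : z ^ 2 = w ^ 2) :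
    z = w := by
  rcases sq_eq_sq_iff_eq_or_eq_neg.1 h with h | h
  · exact h
  · rw [h, neg_im] at hz
    linarith

lemma one_sub_sq_ne_zero {δ : ℝ} (hδ : 0 < δ) (hδ1 : δ < 1) : 1 - (δ : ℂ) ^ 2 ≠ 0 := by
  have : 1 - δ ^ 2 ≠ 0 := by nlinarith
  exact_mod_cast this

lemma phiSlit_injOn {δ : ℝ} (hδ : 0 < δ) (hδ1 : δ < 1) :
    Set.InjOn (phiSlit δ) {z : ℂ | 0 < z.im} := by
  intro z hz w hw h
  refine eq_of_sq_eq_sq_of_im_pos hz hw (mul_right_cancel₀ (one_sub_sq_ne_zero hδ hδ1) ?_)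
  have := congrArg (· ^ 2) h
  simp only [phiSlit_sq δ (ne_zero_of_im_pos hz), phiSlit_sq δ (ne_zero_of_im_pos hw)] at this
  linear_combination this

lemma exists_sq_eq_of_not_nonneg {u : ℂ} (hu : ∀ x : ℝ, 0 ≤ x → u ≠ x) :
    ∃ z : ℂ, 0 < z.im ∧ z ^ 2 = u := by
  have hs := cpow_half_sq u
  set s := u ^ ((1 : ℂ) / 2)
  rcases lt_trichotomy s.im 0 with h | h | h
  · exact ⟨-s, by simpa using h, by rw [neg_sq, hs]⟩
  · refine absurd ?_ (hu (s.re ^ 2) (sq_nonneg _))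
    have : s = (s.re : ℂ) := Complex.ext (by simp) (by simp [h])
    rw [← hs, this]
    simp
  · exact ⟨s, h, hs⟩

lemma eq_mul_I_of_sq {z : ℂ} (hz : 0 < z.im) {x : ℝ} (hx : 0 < x) (h : z ^ 2 = -(x : ℂ)) :
    z = (Real.sqrt x : ℝ) * I := by
  refine eq_of_sq_eq_sq_of_im_pos hz (by simpa using hx) ?_
  rw [h, mul_pow, I_sq, ← ofReal_pow, Real.sq_sqrt hx.le]
  ring

/-- Among points of the upper half-plane, `φ^δ` sends exactly those of the ray above `i` into it. -/
lemma phiSlit_mem_slitHalfPlane_iff {δ : ℝ} (hδ : 0 < δ) (hδ1 : δ < 1) {z : ℂ} (hz : 0 < z.im) :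
    phiSlit δ z ∈ slitHalfPlane ↔ z ∈ slitHalfPlane := by
  have hφ := phiSlit_im_pos hδ hδ1 hz
  have hsq := phiSlit_sq δ (ne_zero_of_im_pos hz)
  have hpos : 0 < 1 - δ ^ 2 := by nlinarith
  have hne := one_sub_sq_ne_zero hδ hδ1
  constructor
  · rintro ⟨-, h⟩
    refine ⟨hz, fun t ht hzt => ?_⟩
    have h1 : 1 ≤ t ^ 2 * (1 - δ ^ 2) + δ ^ 2 := by
      nlinarith [mul_le_mul_of_nonneg_right (one_le_pow₀ (n := 2) ht) hpos.le]
    refine h _ (Real.one_le_sqrt.2 h1) (eq_mul_I_of_sq hφ (by linarith) ?_)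
    rw [hsq, hzt, mul_pow, I_sq]
    push_cast
    ring
  · rintro ⟨-, h⟩
    refine ⟨hφ, fun t ht hφt => ?_⟩
    have h1 : 1 ≤ (t ^ 2 - δ ^ 2) / (1 - δ ^ 2) := by
      rw [le_div_iff₀ hpos]; nlinarith
    refine h _ (Real.one_le_sqrt.2 h1) (eq_mul_I_of_sq hz (by linarith) ?_)
    rw [hφt, mul_pow, I_sq] at hsq
    push_cast
    field_simp
    linear_combination -hsq

lemma phiSlit_ne_of_mem_slit {δ : ℝ} (hδ : 0 < δ) (hδ1 : δ < 1) {z : ℂ} (hz : 0 < z.im) {t : ℝ}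
    (ht : 0 < t) (htδ : t ≤ δ) : phiSlit δ z ≠ t * I := by
  intro h
  have hsq := phiSlit_sq δ (ne_zero_of_im_pos hz)
  rw [h, mul_pow, I_sq] at hsq
  have hpos : 0 < 1 - δ ^ 2 := by nlinarith
  have hx : 0 ≤ (δ ^ 2 - t ^ 2) / (1 - δ ^ 2) := div_nonneg (by nlinarith) hpos.le
  have hz2 : z ^ 2 = (Real.sqrt ((δ ^ 2 - t ^ 2) / (1 - δ ^ 2)) : ℂ) ^ 2 := by
    rw [← ofReal_pow, Real.sq_sqrt hx]
    push_cast
    rw [eq_div_iff (one_sub_sq_ne_zero hδ hδ1)]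
    linear_combination -hsq
  rcases sq_eq_sq_iff_eq_or_eq_neg.1 hz2 with h | h <;>
  · rw [h] at hz
    simp at hz

lemma exists_phiSlit_eq {δ : ℝ} (hδ : 0 < δ) (hδ1 : δ < 1) {w : ℂ} (hw : 0 < w.im)
    (hslit : ∀ t : ℝ, 0 < t → t ≤ δ → w ≠ t * I) : ∃ z : ℂ, 0 < z.im ∧ phiSlit δ z = w := by
  have hpos : 0 < 1 - δ ^ 2 := by nlinarith
  have hne := one_sub_sq_ne_zero hδ hδ1
  obtain ⟨z, hz, hzw⟩ := exists_sq_eq_of_not_nonneg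
    (u := (w ^ 2 + (δ : ℂ) ^ 2) / (1 - (δ : ℂ) ^ 2)) (fun x hx h => by
      rw [div_eq_iff hne] at h
      have hre := congrArg re h
      have him := congrArg im h
      have e1 : 1 - (δ : ℂ) ^ 2 = ((1 - δ ^ 2 : ℝ) : ℂ) := by push_cast; rfl
      rw [e1, ← ofReal_pow] at hre him
      simp only [pow_two w, add_re, add_im, mul_re, mul_im, ofReal_re, ofReal_im] at hre him
      have hx0 : w.re = 0 := by
        have : w.re * w.im = 0 := by linarith
        exact (mul_eq_zero.1 this).resolve_right hw.ne'
      refine hslit w.im hw ?_ (Complex.ext (by simp [hx0]) (by simp))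
      rw [hx0] at hre
      have := mul_nonneg hx hpos.le
      nlinarith)
  refine ⟨z, hz, eq_of_sq_eq_sq_of_im_pos (phiSlit_im_pos hδ hδ1 hz) hw ?_⟩
  rw [phiSlit_sq δ (ne_zero_of_im_pos hz), hzw]
  field_simp
  ring

lemma gMap_fN_mul_I {N : ℝ} (t : ℝ) :
    gMap (fN N (t * I)) = (((Real.exp (t / N) - 1) / (Real.exp (t / N) + 1) : ℝ) : ℂ) * I := by
  have : -I * (t * I) / N = ((t / N : ℝ) : ℂ) := by
    push_cast
    linear_combination (-(t : ℂ) / N) * I_sq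
  rw [gMap, fN, this, ← ofReal_exp]
  push_cast
  ring

/-- In half-plane coordinates the slit of the strip is the segment from `0` to `iδ`. -/
lemma mem_slit_iff {N δ : ℝ} (hN : 0 < N) (hδ1 : δ < 1) {ζ : ℂ} (hζ : ζ ∈ openStrip N) :
    (∃ t : ℝ, 0 < t ∧ t ≤ N * Real.log ((1 + δ) / (1 - δ)) ∧ ζ = t * I) ↔
      ∃ s : ℝ, 0 < s ∧ s ≤ δ ∧ gMap (fN N ζ) = s * I := by
  constructor
  · rintro ⟨t, ht, htle, rfl⟩
    have hr : 1 < Real.exp (t / N) := Real.one_lt_exp_iff.2 (by positivity)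
    refine ⟨_, div_pos (sub_pos.2 hr) (by linarith), ?_, gMap_fN_mul_I t⟩
    have hlog : 0 < Real.log ((1 + δ) / (1 - δ)) := pos_of_mul_pos_right (by linarith) hN.le
    have hδ : 0 < 1 + δ := by
      by_contra hneg
      have hδm : δ ≤ -1 := by linarith
      have : |(1 + δ) / (1 - δ)| ≤ 1 := by
        rw [abs_div, abs_of_nonpos (by linarith : 1 + δ ≤ 0), abs_of_pos (by linarith : 0 < 1 - δ),
          div_le_one (by linarith)]
        linarith
      rw [← Real.log_abs] at hlog
      exact hlog.not_ge (Real.log_nonpos (abs_nonneg _) this)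
    have h1 : 0 < (1 + δ) / (1 - δ) := div_pos hδ (by linarith)
    have h2 : Real.exp (t / N) ≤ (1 + δ) / (1 - δ) := by
      rw [← Real.le_log_iff_exp_le h1, div_le_iff₀ hN]
      linarith
    rw [le_div_iff₀ (by linarith)] at h2
    rw [div_le_iff₀ (by linarith)]
    linarith
  · rintro ⟨s, hs, hsδ, h⟩
    have hv := fN_mapsTo hN hζ
    have hpos : 0 < (1 + s) / (1 - s) := div_pos (by linarith) (by linarith)
    have hfN : fN N ζ = (((1 + s) / (1 - s) : ℝ) : ℂ) := by
      rw [← gInv_gMap (add_one_ne_zero_of_mem_slitExterior hv), h, gInv]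
      have : (1 : ℂ) - s ≠ 0 := by
        have : 1 - s ≠ 0 := by linarith
        exact_mod_cast this
      have e : I - s * I = (1 - s) * I := by ring
      rw [e]
      push_cast
      field_simp
    refine ⟨N * Real.log ((1 + s) / (1 - s)), ?_, ?_, ?_⟩
    · refine mul_pos hN (Real.log_pos ?_)
      rw [one_lt_div (by linarith)]
      linarith
    · refine mul_le_mul_of_nonneg_left (Real.log_le_log hpos ?_) hN.le
      rw [div_le_div_iff₀ (by linarith) (by linarith)]
      nlinarith
    · rw [← fNinv_fN hN hζ, hfN, fNinv, ← ofReal_log hpos.le]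
      push_cast
      ring

/-- The cylindrical slit map is a conformal map of the strip
`Σ_N = {-Nπ < Re z < Nπ, Im z > 0}` onto the strip with a vertical slit of length
`λ(δ) = N log((1+δ)/(1-δ))` above the origin removed. -/
theorem cylSlit_conformal_onto_slit_strip (N δ : ℝ) (hN : 0 < N) (hδ : 0 < δ) (hδ1 : δ < 1) :
    DifferentiableOn ℂ (cylSlit N δ)
      {z : ℂ | -(N * Real.pi) < z.re ∧ z.re < N * Real.pi ∧ 0 < z.im} ∧
    Set.InjOn (cylSlit N δ)
      {z : ℂ | -(N * Real.pi) < z.re ∧ z.re < N * Real.pi ∧ 0 < z.im} ∧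
    cylSlit N δ '' {z : ℂ | -(N * Real.pi) < z.re ∧ z.re < N * Real.pi ∧ 0 < z.im}
      = {z : ℂ | -(N * Real.pi) < z.re ∧ z.re < N * Real.pi ∧ 0 < z.im}
        \ {w : ℂ | ∃ t : ℝ, 0 < t ∧ t ≤ N * Real.log ((1 + δ) / (1 - δ)) ∧ w = t * Complex.I} := by
  change DifferentiableOn ℂ (cylSlit N δ) (openStrip N) ∧ Set.InjOn (cylSlit N δ) (openStrip N) ∧
    cylSlit N δ '' openStrip N = openStrip N \ _
  have hD : Set.MapsTo (fun z => gMap (fN N z)) (openStrip N) slitHalfPlane :=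
    fun z hz => gMap_mapsTo (fN_mapsTo hN hz)
  have hφ : ∀ z ∈ openStrip N, phiSlit δ (gMap (fN N z)) ∈ slitHalfPlane := fun z hz =>
    (phiSlit_mem_slitHalfPlane_iff hδ hδ1 (hD hz).1).2 (hD hz)
  have hleft : ∀ z ∈ openStrip N, fNinv N (gInv (gMap (fN N z))) = z := fun z hz => by
    rw [gInv_gMap (add_one_ne_zero_of_mem_slitExterior (fN_mapsTo hN hz)), fNinv_fN hN hz]
  have hright : ∀ w ∈ slitHalfPlane, gMap (fN N (fNinv N (gInv w))) = w := fun w hw => by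
    rw [fN_fNinv hN (slitPlane_ne_zero (gInv_mapsTo hw).2),
      gMap_gInv (I_sub_ne_zero_of_mem_slitHalfPlane hw)]
  have hconj : ∀ z ∈ openStrip N, gMap (fN N (cylSlit N δ z)) = phiSlit δ (gMap (fN N z)) :=
    fun z hz => hright _ (hφ z hz)
  refine ⟨fun z hz => DifferentiableAt.differentiableWithinAt ?_, fun z hz w hw h => ?_, ?_⟩
  · have d1 : DifferentiableAt ℂ (fN N) z := by unfold fN; fun_prop
    have d2 : DifferentiableAt ℂ gMap (fN N z) := by
      have := add_one_ne_zero_of_mem_slitExterior (fN_mapsTo hN hz)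
      unfold gMap; fun_prop (disch := assumption)
    have d3 : DifferentiableAt ℂ (phiSlit δ) (gMap (fN N z)) := by
      have him := (hD hz).1
      have h0 := pow_ne_zero 2 (ne_zero_of_im_pos him)
      have hu := phiSlit_radicand_mem_slitPlane hδ hδ1 him
      unfold phiSlit
      exact differentiableAt_id.mul
        (DifferentiableAt.cpow_const (by fun_prop (disch := assumption)) hu)
    have d4 : DifferentiableAt ℂ gInv (phiSlit δ (gMap (fN N z))) := by
      have := I_sub_ne_zero_of_mem_slitHalfPlane (hφ z hz)
      unfold gInv; fun_prop (disch := assumption)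
    have d5 : DifferentiableAt ℂ (fNinv N) (gInv (phiSlit δ (gMap (fN N z)))) := by
      have := (gInv_mapsTo (hφ z hz)).2
      unfold fNinv; fun_prop (disch := assumption)
    have d12 : DifferentiableAt ℂ (gMap ∘ fN N) z := d2.comp z d1
    have d13 : DifferentiableAt ℂ (phiSlit δ ∘ gMap ∘ fN N) z := DifferentiableAt.comp z d3 d12
    have d14 : DifferentiableAt ℂ (gInv ∘ phiSlit δ ∘ gMap ∘ fN N) z :=
      DifferentiableAt.comp z d4 d13
    exact DifferentiableAt.comp z d5 d14
  · have h1 := hconj z hz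
    rw [h, hconj w hw] at h1
    have h2 : gMap (fN N w) = gMap (fN N z) :=
      phiSlit_injOn hδ hδ1 (hD hw).1 (hD hz).1 h1
    rw [← hleft z hz, ← hleft w hw, h2]
  · ext ζ
    constructor
    · rintro ⟨z, hz, rfl⟩
      have hmem : cylSlit N δ z ∈ openStrip N := fNinv_mapsTo hN (gInv_mapsTo (hφ z hz))
      refine ⟨hmem, fun h => ?_⟩
      obtain ⟨s, hs, hsδ, h⟩ := (mem_slit_iff hN hδ1 hmem).1 h
      rw [hconj z hz] at h
      exact phiSlit_ne_of_mem_slit hδ hδ1 (hD hz).1 hs hsδ h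
    · rintro ⟨hζ, hslit⟩
      obtain ⟨y, hy, hyζ⟩ := exists_phiSlit_eq hδ hδ1 (hD hζ).1
        (fun t ht htδ h => hslit ((mem_slit_iff hN hδ1 hζ).2 ⟨t, ht, htδ, h⟩))
      have hyD : y ∈ slitHalfPlane := by
        rw [← phiSlit_mem_slitHalfPlane_iff hδ hδ1 hy, hyζ]
        exact hD hζ
      refine ⟨fNinv N (gInv y), fNinv_mapsTo hN (gInv_mapsTo hyD), ?_⟩
      rw [cylSlit, hright y hyD, hyζ]
      exact hleft ζ hζ
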